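/- Let $X_1,X_2,\dots$ be a stationary Markov chain with $\psi$-irreducible kernel $P$, stationary law $\pi$, and spectral gap condition $\|P-\Pi\|_{L^2(\pi)}=\lambda<1$. Let $f:\mathcal{X}\to[0,1]$, $\mu=\pi(f)$, $S_n=\sum_{k=1}^nf(X_k)$. Then for all $\varepsilon>0$ with $\mu+\varepsilon<1$: $\mathbb{P}_\pi(S_n\ge n(\mu+\varepsilon))\le\exp\left(-2\frac{1-\lambda}{1+\lambda}\varepsilon^2 n\right)$. -/

import Mathlib

open MeasureTheory ProbabilityTheory

theorem sinh_lt_mul_cosh {x : ℝ} (hx : 0 < x) : Real.sinh x < x * Real.cosh x := by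
  have hd : ∀ y : ℝ, HasDerivAt (fun y => y * Real.cosh y - Real.sinh y) (y * Real.sinh y) y := by
    intro y
    have := ((hasDerivAt_id y).mul (Real.hasDerivAt_cosh y)).sub (Real.hasDerivAt_sinh y)
    refine this.congr_deriv ?_
    simp only [id]
    ring
  have hmono : StrictMonoOn (fun y => y * Real.cosh y - Real.sinh y) (Set.Ici 0) := by
    refine strictMonoOn_of_deriv_pos (convex_Ici 0)
      (fun y _ => (hd y).continuousAt.continuousWithinAt) fun y hy => ?_
    rw [interior_Ici] at hy
    rw [(hd y).deriv]
    exact mul_pos hy (Real.sinh_pos_iff.2 hy)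
  have := hmono (Set.mem_Ici.2 le_rfl) (Set.mem_Ici.2 hx.le) hx
  simp at this
  linarith

theorem cosh_add_sub_mul_sinh_le_cosh (z w : ℝ) :
    Real.cosh w + (z - w) * Real.sinh w ≤ Real.cosh z := by
  have h1 : Real.exp w * (z - w + 1) ≤ Real.exp z := by
    have := mul_le_mul_of_nonneg_left (Real.add_one_le_exp (z - w)) (Real.exp_pos w).le
    rwa [← Real.exp_add, add_sub_cancel] at this
  have h2 : Real.exp (-w) * (w - z + 1) ≤ Real.exp (-z) := by
    have := mul_le_mul_of_nonneg_left (Real.add_one_le_exp (w - z)) (Real.exp_pos (-w)).le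
    rwa [← Real.exp_add, show -w + (w - z) = -z by ring] at this
  rw [Real.cosh_eq, Real.cosh_eq, Real.sinh_eq]
  linarith

theorem arsinh_sinh_mul_sinhc_le {b s : ℝ} (hb : 0 < b) (hs : 0 < s) :
    Real.arsinh (Real.sinh b * (Real.sinh s / s)) ≤
      b + Real.cosh b / Real.sinh b * s ^ 2 / 2 := by
  have hsb : 0 < Real.sinh b := Real.sinh_pos_iff.2 hb
  set y := Real.cosh b / Real.sinh b * s ^ 2 / 2 with hy
  have hc : 1 ≤ Real.cosh b / Real.sinh b := by
    rw [one_le_div hsb]; exact (Real.sinh_lt_cosh b).le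
  have hys : s ^ 2 / 2 ≤ y := by rw [hy]; nlinarith [sq_nonneg s]
  have hy0 : 0 ≤ y := le_trans (by positivity) hys
  rw [← Real.sinh_le_sinh, Real.sinh_arsinh, Real.sinh_add]
  have h1 : Real.sinh s / s ≤ Real.cosh s := by
    rw [div_le_iff₀ hs, mul_comm]; exact (sinh_lt_mul_cosh hs).le
  have h2 : Real.cosh s ≤ Real.cosh y + Real.sinh y := by
    rw [Real.cosh_add_sinh]
    exact (Real.cosh_le_exp_half_sq s).trans (Real.exp_le_exp.2 hys)
  calc _ ≤ Real.sinh b * (Real.cosh y + Real.sinh y) := by gcongr; exact h1.trans h2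
    _ ≤ _ := by
      have := mul_le_mul_of_nonneg_right (Real.sinh_lt_cosh b).le (Real.sinh_nonneg_iff.2 hy0)
      linarith

theorem cosh_arsinh_sub_nonneg {b s : ℝ} (hb : 0 < b) (hs : 0 < s) :
    0 ≤ √(1 + (Real.sinh b * (Real.sinh s / s)) ^ 2)
      - Real.arsinh (Real.sinh b * (Real.sinh s / s)) * (Real.sinh b * (Real.sinh s / s))
      + b * (Real.sinh b * (Real.sinh s / s))
      + Real.cosh b * (s * Real.sinh s / 2 - Real.cosh s) := by
  have hsb : 0 < Real.sinh b := Real.sinh_pos_iff.2 hb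
  let k : ℝ → ℝ := dslope Real.sinh 0
  have hk : ∀ t, t ≠ 0 → k t = Real.sinh t / t := fun t ht => by
    simp [k, dslope_of_ne _ ht, slope_def_field]
  have hk0 : k 0 = 1 := by simp [k]
  have hkc : Continuous k := by
    rw [← continuousOn_univ]
    exact (continuousOn_dslope Filter.univ_mem).2
      ⟨Real.continuous_sinh.continuousOn, Real.differentiable_sinh 0⟩
  let H : ℝ → ℝ := fun t => √(1 + (Real.sinh b * k t) ^ 2)
      - Real.arsinh (Real.sinh b * k t) * (Real.sinh b * k t) + b * (Real.sinh b * k t)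
      + Real.cosh b * (t * Real.sinh t / 2 - Real.cosh t)
  have hHc : Continuous H := by
    have h1 := Real.continuous_sinh
    have h2 := Real.continuous_cosh
    have h3 : Continuous fun t => Real.arsinh (Real.sinh b * k t) :=
      Real.continuous_arsinh.comp (by fun_prop)
    fun_prop
  have hkd : ∀ t, 0 < t → HasDerivAt k ((t * Real.cosh t - Real.sinh t) / t ^ 2) t := by
    intro t ht
    have := (Real.hasDerivAt_sinh t).div (hasDerivAt_id t) ht.ne'
    refine (this.congr_of_eventuallyEq ?_).congr_deriv ?_
    · filter_upwards [eventually_ne_nhds ht.ne'] with u hu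
      simp [hk u hu]
    · simp [mul_comm]
  have hHd : ∀ t, 0 < t → HasDerivAt H ((t * Real.cosh t - Real.sinh t) *
      (Real.cosh b / 2 - (Real.arsinh (Real.sinh b * k t) - b) * Real.sinh b / t ^ 2)) t := by
    intro t ht
    have hq := (hkd t ht).const_mul (Real.sinh b)
    have hpos : 0 < 1 + (Real.sinh b * k t) ^ 2 := by positivity
    have h1 := ((hq.pow 2).const_add 1).sqrt hpos.ne'
    have h2 := (hq.arsinh).mul hq
    have h3 := hq.const_mul b
    have h4 := ((((hasDerivAt_id t).mul (Real.hasDerivAt_sinh t)).div_const 2).sub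
      (Real.hasDerivAt_cosh t)).const_mul (Real.cosh b)
    refine (((h1.sub h2).add h3).add h4).congr_deriv ?_
    have : √(1 + (Real.sinh b * k t) ^ 2) ≠ 0 := (Real.sqrt_pos.2 hpos).ne'
    simp only [id, Pi.pow_apply, smul_eq_mul]
    field_simp
    ring
  have hmono : MonotoneOn H (Set.Ici 0) := by
    refine monotoneOn_of_deriv_nonneg (convex_Ici 0) hHc.continuousOn ?_ ?_
    · rw [interior_Ici]
      exact fun t ht => (hHd t ht).differentiableAt.differentiableWithinAt
    · rw [interior_Ici]
      intro t ht
      have ht : 0 < t := ht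
      rw [(hHd t ht).deriv]
      refine mul_nonneg (by linarith [sinh_lt_mul_cosh ht]) ?_
      have := arsinh_sinh_mul_sinhc_le hb ht
      rw [← hk t ht.ne'] at this
      rw [sub_nonneg, div_le_iff₀ (by positivity)]
      calc _ ≤ (Real.cosh b / Real.sinh b * t ^ 2 / 2) * Real.sinh b := by
            gcongr; linarith
        _ = _ := by field_simp
  have h0 : H 0 = 0 := by
    have : √(1 + Real.sinh b ^ 2) = Real.cosh b := by
      rw [← Real.cosh_arsinh, Real.arsinh_sinh]
    simp [H, hk0, this]
  have := hmono (Set.mem_Ici.2 le_rfl) (Set.mem_Ici.2 hs.le) hs.le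
  rw [h0] at this
  simpa only [H, hk s hs.ne'] using this

theorem cosh_mul_cosh_add_le {b s : ℝ} (hb : 0 < b) (hs : 0 < s) (m : ℝ) :
    Real.cosh b * Real.cosh s + m * (Real.sinh b * Real.sinh s) ≤
      Real.cosh (b + m * s + Real.cosh b / Real.sinh b * s ^ 2 / 2) := by
  have hsb : 0 < Real.sinh b := Real.sinh_pos_iff.2 hb
  have h1 := cosh_add_sub_mul_sinh_le_cosh (b + m * s + Real.cosh b / Real.sinh b * s ^ 2 / 2)
    (Real.arsinh (Real.sinh b * (Real.sinh s / s)))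
  have h2 := cosh_arsinh_sub_nonneg hb hs
  rw [Real.sinh_arsinh, Real.cosh_arsinh] at h1
  have h3 : (m * s + Real.cosh b / Real.sinh b * s ^ 2 / 2) * (Real.sinh b * (Real.sinh s / s))
      = m * (Real.sinh b * Real.sinh s) + Real.cosh b * (s * Real.sinh s / 2) := by
    field_simp
  nlinarith [h1, h2, h3]

theorem two_point_bound {lam θ μ : ℝ} (h0 : 0 < lam) (h1 : lam < 1) (hθ : 0 < θ) (hμ : 0 ≤ μ)
    {R : ℝ} (hR : R = Real.exp (θ * μ + (1 + lam) / (1 - lam) * θ ^ 2 / 8)) :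
    lam * Real.exp θ < R ∧
      (1 - lam) * ((1 - μ) / (R - lam) + μ * (Real.exp θ / (R - lam * Real.exp θ))) ≤ 1 := by
  obtain ⟨b, hb, rfl⟩ : ∃ b : ℝ, 0 < b ∧ Real.exp (-(2 * b)) = lam :=
    ⟨-Real.log lam / 2, by linarith [Real.log_neg h0 h1], by
      rw [show -(2 * (-Real.log lam / 2)) = Real.log lam by ring, Real.exp_log h0]⟩
  obtain ⟨s, hs, rfl⟩ : ∃ s : ℝ, 0 < s ∧ 2 * s = θ := ⟨θ / 2, by linarith, by ring⟩
  have hsb : 0 < Real.sinh b := Real.sinh_pos_iff.2 hb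
  set c := Real.cosh b / Real.sinh b with hc
  have hp2 : Real.exp (-(2 * b)) = Real.exp (-b) ^ 2 := by
    rw [← Real.exp_nat_mul]; congr 1; push_cast; ring
  have hW : Real.exp (2 * s) = Real.exp s ^ 2 := by
    rw [← Real.exp_nat_mul]; congr 1
  have hcl : (1 + Real.exp (-(2 * b))) / (1 - Real.exp (-(2 * b))) = c := by
    have e1 : 1 + Real.exp (-(2 * b)) = 2 * Real.exp (-b) * Real.cosh b := by
      rw [Real.cosh_eq, hp2, Real.exp_neg]; field_simp
    have e2 : 1 - Real.exp (-(2 * b)) = 2 * Real.exp (-b) * Real.sinh b := by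
      rw [Real.sinh_eq, hp2, Real.exp_neg]; field_simp
    rw [e1, e2, hc]; field_simp
  have hR' : R = Real.exp (b + (2 * μ - 1) * s + c * s ^ 2 / 2) * Real.exp (-b) * Real.exp s := by
    rw [hR, hcl, ← Real.exp_add, ← Real.exp_add]; congr 1; ring
  have hlt : Real.exp (-(2 * b)) * Real.exp (2 * s) < R := by
    rw [hR, hcl, ← Real.exp_add, Real.exp_lt_exp]
    have hbc : 1 < b * c := by
      rw [hc, ← mul_div_assoc, one_lt_div hsb]; exact sinh_lt_mul_cosh hb
    have hc0 : 0 < c := div_pos (Real.cosh_pos b) hsb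
    have : 0 < c * (c * s ^ 2 - 4 * s + 4 * b) := by nlinarith [sq_nonneg (c * s - 2)]
    have := pos_of_mul_pos_right this hc0.le
    nlinarith [mul_nonneg hs.le hμ]
  refine ⟨hlt, ?_⟩
  have hW1 : 1 < Real.exp (2 * s) := by simpa using hs
  have hq : 0 < R - Real.exp (-(2 * b)) * Real.exp (2 * s) := sub_pos.2 hlt
  have hp : 0 < R - Real.exp (-(2 * b)) := by nlinarith
  have key := cosh_mul_cosh_add_le hb hs (2 * μ - 1)
  rw [← hc] at key
  rw [mul_div_assoc', div_add_div _ _ hp.ne' hq.ne', mul_div_assoc', div_le_one (mul_pos hp hq)]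
  rw [hp2, hW, hR']
  rw [Real.cosh_eq, Real.cosh_eq, Real.cosh_eq, Real.sinh_eq, Real.sinh_eq, Real.exp_neg b,
    Real.exp_neg s, Real.exp_neg (b + _ + _)] at key
  rw [Real.exp_neg b]
  set V := Real.exp (b + (2 * μ - 1) * s + c * s ^ 2 / 2)
  set E := Real.exp s
  set B := Real.exp b
  have hV : 0 < V := Real.exp_pos _
  have hE : 0 < E := Real.exp_pos _
  have hB : 0 < B := Real.exp_pos _
  have key2 := mul_le_mul_of_nonneg_left key (show 0 ≤ 2 * (V * E ^ 2 / B ^ 2) by positivity)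
  rw [← sub_nonneg] at key2 ⊢
  refine key2.trans_eq ?_
  field_simp
  ring

theorem div_sub_mul_le_chord {lam R W E : ℝ} (h0 : 0 ≤ lam) {y : ℝ} (hy : 0 ≤ y)
    (hy1 : y ≤ 1) (hEW : E ≤ 1 - y + y * W) (hW : 1 ≤ W) (hR : lam * W < R) :
    E / (R - lam * E) ≤ (1 - y) / (R - lam) + y * (W / (R - lam * W)) := by
  have hq : 0 < R - lam * W := sub_pos.2 hR
  have hp : 0 < R - lam := by nlinarith
  have hR0 : 0 ≤ R := by nlinarith
  have hL : 1 - y + y * W ≤ W := by nlinarith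
  have hr : 0 < R - lam * (1 - y + y * W) := by nlinarith
  calc E / (R - lam * E) ≤ (1 - y + y * W) / (R - lam * (1 - y + y * W)) := by
        gcongr
    _ ≤ _ := by
        rw [← sub_nonneg]
        have : (1 - y) / (R - lam) + y * (W / (R - lam * W)) -
            (1 - y + y * W) / (R - lam * (1 - y + y * W)) = y * (1 - y) * (W - 1) ^ 2 * (R * lam) /
            ((R - lam) * (R - lam * W) * (R - lam * (1 - y + y * W))) := by
          field_simp
          ring
        rw [this]
        have : 0 ≤ 1 - y := by linarith
        positivity

/-- Bounded measurable real functions. -/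
def BddMeasurable {X : Type*} [MeasurableSpace X] (a : X → ℝ) : Prop :=
  Measurable a ∧ ∃ C, ∀ x, |a x| ≤ C

namespace BddMeasurable

variable {X : Type*} [MeasurableSpace X] {a b : X → ℝ}

theorem mul (ha : BddMeasurable a) (hb : BddMeasurable b) : BddMeasurable fun x => a x * b x := by
  obtain ⟨ha, C, hC⟩ := ha
  obtain ⟨hb, D, hD⟩ := hb
  refine ⟨ha.mul hb, C * D, fun x => ?_⟩
  rw [abs_mul]
  exact mul_le_mul (hC x) (hD x) (abs_nonneg _) ((abs_nonneg _).trans (hC x))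

theorem sub_const (ha : BddMeasurable a) (c : ℝ) : BddMeasurable fun x => a x - c := by
  obtain ⟨ha, C, hC⟩ := ha
  exact ⟨ha.sub_const c, C + |c|, fun x => (abs_sub _ _).trans (by gcongr; exact hC x)⟩

theorem pow (ha : BddMeasurable a) (n : ℕ) : BddMeasurable fun x => a x ^ n := by
  obtain ⟨ha, C, hC⟩ := ha
  refine ⟨ha.pow_const n, C ^ n, fun x => ?_⟩
  rw [abs_pow]
  exact pow_le_pow_left₀ (abs_nonneg _) (hC x) n

theorem memLp (ha : BddMeasurable a) (μ : Measure X) [IsFiniteMeasure μ] : MemLp a 2 μ := by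
  obtain ⟨ha, C, hC⟩ := ha
  exact MemLp.of_bound ha.aestronglyMeasurable C (ae_of_all _ hC)

theorem integrable (ha : BddMeasurable a) (μ : Measure X) [IsFiniteMeasure μ] :
    Integrable a μ := by
  obtain ⟨ha, C, hC⟩ := ha
  exact Integrable.of_bound ha.aestronglyMeasurable C (ae_of_all _ hC)

theorem integral_kernel (ha : BddMeasurable a) (κ : Kernel X X) [IsMarkovKernel κ] :
    BddMeasurable fun x => ∫ y, a y ∂κ x := by
  obtain ⟨ha, C, hC⟩ := ha
  refine ⟨(ha.stronglyMeasurable.integral_kernel).measurable, C, fun x => ?_⟩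
  have := norm_integral_le_of_norm_le_const (μ := κ x) (f := a) (C := C) (ae_of_all _ hC)
  simpa using this

theorem integral_sub_sq (ha : BddMeasurable a) (μ : Measure X) [IsProbabilityMeasure μ] :
    ∫ x, (a x - ∫ y, a y ∂μ) ^ 2 ∂μ = ∫ x, a x ^ 2 ∂μ - (∫ x, a x ∂μ) ^ 2 := by
  have e : ∀ x, (a x - ∫ y, a y ∂μ) ^ 2 =
      a x ^ 2 - (2 * ∫ y, a y ∂μ) * a x + (∫ y, a y ∂μ) ^ 2 := fun x => by ring
  simp_rw [e]
  rw [integral_add (((ha.pow 2).integrable μ).sub' ((ha.integrable μ).const_mul _))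
    (integrable_const _), integral_sub ((ha.pow 2).integrable μ) ((ha.integrable μ).const_mul _),
    integral_const_mul]
  simp
  ring

theorem sq_integral_le (ha : BddMeasurable a) (μ : Measure X) [IsProbabilityMeasure μ] :
    (∫ x, a x ∂μ) ^ 2 ≤ ∫ x, a x ^ 2 ∂μ := by
  have h : 0 ≤ ∫ x, (a x - ∫ y, a y ∂μ) ^ 2 ∂μ := integral_nonneg fun _ => sq_nonneg _
  rw [ha.integral_sub_sq] at h
  linarith

end BddMeasurable

/-- The quadratic form `a ↦ ⟨a, (lam I + (1 - lam) Π) a⟩`. -/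
noncomputable def mixForm {X : Type*} [MeasurableSpace X] (π : Measure X) (lam : ℝ)
    (a : X → ℝ) : ℝ :=
  lam * ∫ x, a x ^ 2 ∂π + (1 - lam) * (∫ x, a x ∂π) ^ 2

theorem mixForm_nonneg {X : Type*} [MeasurableSpace X] {π : Measure X} {lam : ℝ}
    (h0 : 0 ≤ lam) (h1 : lam ≤ 1) (a : X → ℝ) : 0 ≤ mixForm π lam a :=
  add_nonneg (mul_nonneg h0 (integral_nonneg fun _ => sq_nonneg _))
    (mul_nonneg (sub_nonneg.2 h1) (sq_nonneg _))

theorem integral_integral_kernel {X : Type*} [MeasurableSpace X] {π : Measure X}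
    [IsProbabilityMeasure π] {κ : Kernel X X} (hinv : π.bind κ = π) {a : X → ℝ} (ha : BddMeasurable a) :
    ∫ x, ∫ y, a y ∂κ x ∂π = ∫ x, a x ∂π := by
  have h : (κ ∘ₖ Kernel.const Unit π) () = π := by
    rw [Kernel.comp_apply, Kernel.const_apply, hinv]
  have := Kernel.integral_comp (η := κ) (κ := Kernel.const Unit π) (a := ()) (f := a)
    (by rw [h]; exact ha.integrable π)
  rw [h, Kernel.const_apply] at this
  exact this.symm

section SpectralGap

variable {X : Type*} [MeasurableSpace X] {π : Measure X} [IsProbabilityMeasure π]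
  {κ : Kernel X X} [IsMarkovKernel κ] {lam : ℝ}

theorem sq_covariance_le (hinv : π.bind κ = π)
    {P Pi : Lp ℝ 2 π →L[ℝ] Lp ℝ 2 π}
    (hP : ∀ g : Lp ℝ 2 π, P g =ᵐ[π] fun x => ∫ y, g y ∂(κ x))
    (hPi : ∀ g : Lp ℝ 2 π, Pi g =ᵐ[π] fun _ => ∫ y, g y ∂π)
    (hgap : ‖P - Pi‖ ≤ lam) {a b : X → ℝ} (ha : BddMeasurable a) (hb : BddMeasurable b) :
    (∫ x, b x * ∫ y, a y ∂κ x ∂π - (∫ x, a x ∂π) * ∫ x, b x ∂π) ^ 2 ≤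
      lam ^ 2 * (∫ x, a x ^ 2 ∂π) * ∫ x, b x ^ 2 ∂π := by
  have hnorm : ∀ {c : X → ℝ} (hc : BddMeasurable c),
      ‖(hc.memLp π).toLp c‖ ^ 2 = ∫ x, c x ^ 2 ∂π := by
    intro c hc
    rw [← real_inner_self_eq_norm_sq, L2.inner_def]
    refine integral_congr_ae ?_
    filter_upwards [(hc.memLp π).coeFn_toLp] with x hx
    simp [hx, sq]
  set A := (ha.memLp π).toLp a with hA
  set B := (hb.memLp π).toLp b with hB
  have hAa : A =ᵐ[π] a := (ha.memLp π).coeFn_toLp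
  have hBb : B =ᵐ[π] b := (hb.memLp π).coeFn_toLp
  have hPA : P A =ᵐ[π] fun x => ∫ y, a y ∂κ x := by
    have h : ∀ᵐ x ∂(π.bind κ), A x = a x := by rw [hinv]; exact hAa
    filter_upwards [hP A, Measure.ae_ae_of_ae_bind κ.measurable.aemeasurable h] with x hx h'
    rw [hx]
    exact integral_congr_ae h'
  have hPiA : Pi A =ᵐ[π] fun _ => ∫ y, a y ∂π := by
    filter_upwards [hPi A] with x hx
    rw [hx]
    exact integral_congr_ae hAa
  have hinner : inner ℝ B ((P - Pi) A) =
      ∫ x, b x * ∫ y, a y ∂κ x ∂π - (∫ x, a x ∂π) * ∫ x, b x ∂π := by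
    rw [L2.inner_def, ← integral_const_mul, ← integral_sub
      ((hb.mul (ha.integral_kernel κ)).integrable π) ((hb.integrable π).const_mul _)]
    refine integral_congr_ae ?_
    have hsub : ((P - Pi) A : Lp ℝ 2 π) =ᵐ[π] P A - Pi A := Lp.coeFn_sub (P A) (Pi A)
    filter_upwards [hBb, hPA, hPiA, hsub] with x h1 h2 h3 h4
    rw [h4, _root_.Pi.sub_apply, h1, h2, h3]
    simp
    ring
  rw [← hinner, ← hnorm ha, ← hnorm hb, ← sq_abs, ← mul_pow, ← mul_pow]
  refine pow_le_pow_left₀ (abs_nonneg _) ?_ 2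
  calc _ ≤ ‖B‖ * ‖(P - Pi) A‖ := abs_real_inner_le_norm _ _
    _ ≤ ‖B‖ * (lam * ‖A‖) := by
      gcongr
      exact ((P - Pi).le_opNorm A).trans (by gcongr)
    _ = _ := by ring

theorem sq_integral_mul_kernel_le (hinv : π.bind κ = π)
    {P Pi : Lp ℝ 2 π →L[ℝ] Lp ℝ 2 π}
    (hP : ∀ g : Lp ℝ 2 π, P g =ᵐ[π] fun x => ∫ y, g y ∂(κ x))
    (hPi : ∀ g : Lp ℝ 2 π, Pi g =ᵐ[π] fun _ => ∫ y, g y ∂π)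
    (hgap : ‖P - Pi‖ ≤ lam) {a b : X → ℝ} (ha : BddMeasurable a) (hb : BddMeasurable b) :
    (∫ x, b x * ∫ y, a y ∂κ x ∂π) ^ 2 ≤ mixForm π lam a * mixForm π lam b := by
  have hlam : 0 ≤ lam := (norm_nonneg _).trans hgap
  set α := ∫ x, a x ∂π with hα
  set β := ∫ x, b x ∂π with hβ
  have hcov := sq_covariance_le hinv hP hPi hgap (ha.sub_const α) (hb.sub_const β)
  have hcenter : ∀ {c : X → ℝ}, BddMeasurable c → ∫ x, (c x - ∫ y, c y ∂π) ∂π = 0 := by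
    intro c hc
    rw [integral_sub (hc.integrable π) (integrable_const _)]
    simp
  rw [hcenter ha, (ha.integral_sub_sq π), (hb.integral_sub_sq π), zero_mul, sub_zero] at hcov
  have hD : ∫ x, (b x - β) * ∫ y, (a y - α) ∂κ x ∂π = ∫ x, b x * ∫ y, a y ∂κ x ∂π - α * β := by
    have e : ∀ x, (b x - β) * ∫ y, (a y - α) ∂κ x =
        b x * ∫ y, a y ∂κ x - α * b x - (β * ∫ y, a y ∂κ x - α * β) := by
      intro x
      rw [integral_sub (ha.integrable _) (integrable_const _)]
      simp
      ring
    have i1 := (hb.mul (ha.integral_kernel κ)).integrable π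
    have i2 := (ha.integral_kernel κ).integrable π
    simp_rw [e]
    rw [integral_sub (i1.sub' ((hb.integrable π).const_mul _))
        ((i2.const_mul _).sub' (integrable_const _)),
      integral_sub i1 ((hb.integrable π).const_mul _),
      integral_sub (i2.const_mul _) (integrable_const _), integral_const_mul, integral_const_mul,
      integral_integral_kernel hinv ha]
    simp
    ring
  rw [hD] at hcov
  have hA := hα ▸ ha.sq_integral_le π
  have hB := hβ ▸ hb.sq_integral_le π
  unfold mixForm
  rw [← hα, ← hβ]
  generalize ∫ x, a x ^ 2 ∂π = A at *
  generalize ∫ x, b x ^ 2 ∂π = B at *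
  generalize ∫ x, b x * ∫ y, a y ∂κ x ∂π = T at *
  have h2 : |2 * (α * β * (T - α * β))| ≤ lam * (α ^ 2 * (B - β ^ 2) + β ^ 2 * (A - α ^ 2)) := by
    have hA' := sub_nonneg.2 hA
    have hB' := sub_nonneg.2 hB
    refine abs_le_of_sq_le_sq ?_ (by positivity)
    calc _ = 4 * (α ^ 2 * β ^ 2) * (T - α * β) ^ 2 := by ring
      _ ≤ 4 * (α ^ 2 * β ^ 2) * (lam ^ 2 * (A - α ^ 2) * (B - β ^ 2)) := by gcongr
      _ ≤ _ := by
        have := mul_nonneg (sq_nonneg lam)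
          (sq_nonneg (α ^ 2 * (B - β ^ 2) - β ^ 2 * (A - α ^ 2)))
        linarith
  have h3 := le_of_abs_le h2
  linarith

theorem mixForm_mul_le {h g : X → ℝ} (hh : BddMeasurable h) (hg : BddMeasurable g)
    (hlam : lam < 1) {R δ : ℝ} (hδ : 0 < δ) (hd : ∀ x, δ ≤ R - lam * h x ^ 2)
    (hK : (1 - lam) * ∫ x, h x ^ 2 / (R - lam * h x ^ 2) ∂π ≤ 1) :
    mixForm π lam (fun x => h x * g x) ≤ R * ∫ x, g x ^ 2 ∂π := by
  have hdm : BddMeasurable fun x => (R - lam * h x ^ 2)⁻¹ := by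
    refine ⟨((hh.1.pow_const 2).const_mul lam |>.const_sub R).inv, δ⁻¹, fun x => ?_⟩
    rw [abs_of_pos (inv_pos.2 (hδ.trans_le (hd x)))]
    exact inv_anti₀ hδ (hd x)
  have hk : BddMeasurable fun x => h x ^ 2 / (R - lam * h x ^ 2) := by
    simpa only [div_eq_mul_inv] using (hh.pow 2).mul hdm
  set I := ∫ x, h x * g x ∂π with hI
  have i1 := ((hg.pow 2).integrable π).const_mul R
  have i2 := (((hh.mul hg).pow 2).integrable π).const_mul lam
  have i3 := ((hh.mul hg).integrable π).const_mul (2 * (1 - lam) * I)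
  have i4 := (hk.integrable π).const_mul ((1 - lam) ^ 2 * I ^ 2)
  have key : 0 ≤ ∫ x, (R * g x ^ 2 - lam * (h x * g x) ^ 2 - 2 * (1 - lam) * I * (h x * g x) +
      (1 - lam) ^ 2 * I ^ 2 * (h x ^ 2 / (R - lam * h x ^ 2))) ∂π := by
    refine integral_nonneg fun x => ?_
    have hpos := hδ.trans_le (hd x)
    have e : R * g x ^ 2 - lam * (h x * g x) ^ 2 - 2 * (1 - lam) * I * (h x * g x) +
      (1 - lam) ^ 2 * I ^ 2 * (h x ^ 2 / (R - lam * h x ^ 2)) =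
      ((R - lam * h x ^ 2) * g x - (1 - lam) * I * h x) ^ 2 / (R - lam * h x ^ 2) := by
      field_simp
      ring
    simp only [Pi.zero_apply]
    rw [e]
    positivity
  rw [integral_add ((i1.sub' i2).sub' i3) i4, integral_sub (i1.sub' i2) i3, integral_sub i1 i2,
    integral_const_mul, integral_const_mul, integral_const_mul, integral_const_mul, ← hI] at key
  unfold mixForm
  rw [← hI]
  have := mul_le_mul_of_nonneg_left hK (mul_nonneg (sub_nonneg.2 hlam.le) (sq_nonneg I))
  linarith

/-- Iterates of the tilted operator `g ↦ h * P (h * g)` applied to `h`. -/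
noncomputable def tiltIter (κ : Kernel X X) (h : X → ℝ) : ℕ → X → ℝ
  | 0 => h
  | m + 1 => fun x => h x * ∫ y, h y * tiltIter κ h m y ∂κ x

theorem bddMeasurable_tiltIter {h : X → ℝ} (hh : BddMeasurable h) (m : ℕ) :
    BddMeasurable (tiltIter κ h m) := by
  induction m with
  | zero => exact hh
  | succ m ih => exact hh.mul ((hh.mul ih).integral_kernel κ)

theorem integral_mul_tiltIter_le {h : X → ℝ} (hh : BddMeasurable h) {R : ℝ} (hR : 0 ≤ R)
    (hlam0 : 0 ≤ lam) (hlam1 : lam ≤ 1)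
    (hform : ∀ a b, BddMeasurable a → BddMeasurable b →
      (∫ x, b x * ∫ y, a y ∂κ x ∂π) ^ 2 ≤ mixForm π lam a * mixForm π lam b)
    (hmul : ∀ g, BddMeasurable g → mixForm π lam (fun x => h x * g x) ≤ R * ∫ x, g x ^ 2 ∂π)
    (m : ℕ) : ∫ x, h x * tiltIter κ h m x ∂π ≤ R ^ (m + 1) := by
  have hsq : ∀ g, BddMeasurable g → (∫ x, h x * g x ∂π) ^ 2 ≤ R * ∫ x, g x ^ 2 ∂π := by
    intro g hg
    have h1 := hmul g hg
    have h2 := (hh.mul hg).sq_integral_le π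
    unfold mixForm at h1
    nlinarith
  have hnn : ∀ g : X → ℝ, 0 ≤ ∫ x, g x ^ 2 ∂π := fun g => integral_nonneg fun _ => sq_nonneg _
  have cancel : ∀ {T Q : ℝ}, 0 ≤ T → 0 ≤ Q → T ^ 2 ≤ Q * T → T ≤ Q := by
    intro T Q hT hQ h
    rcases hT.eq_or_lt with rfl | hT
    · exact hQ
    · rw [sq] at h
      exact le_of_mul_le_mul_right h hT
  have hmass : ∫ x, h x ^ 2 ∂π ≤ R := by
    refine cancel (hnn h) hR ?_
    have := hsq h hh
    simp_rw [← sq] at this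
    exact this
  have hnorm : ∀ m, ∫ x, tiltIter κ h m x ^ 2 ∂π ≤ R ^ (2 * m + 1) := by
    intro m
    induction m with
    | zero => simpa [tiltIter] using hmass
    | succ m ih =>
      have hm := bddMeasurable_tiltIter (κ := κ) hh m
      have hm1 := bddMeasurable_tiltIter (κ := κ) hh (m + 1)
      have h1 := hform _ _ (hh.mul hm) (hh.mul hm1)
      have e : ∀ x, h x * tiltIter κ h (m + 1) x * ∫ y, h y * tiltIter κ h m y ∂κ x =
          tiltIter κ h (m + 1) x ^ 2 := fun x => by simp only [tiltIter]; ring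
      simp_rw [e] at h1
      have h2 : ∫ x, tiltIter κ h (m + 1) x ^ 2 ∂π ≤ R ^ 2 * ∫ x, tiltIter κ h m x ^ 2 ∂π := by
        refine cancel (hnn _) (mul_nonneg (sq_nonneg R) (hnn _)) (h1.trans ?_)
        refine (mul_le_mul_of_nonneg_left (hmul _ hm1) ?_).trans
          ((mul_le_mul_of_nonneg_right (hmul _ hm) (mul_nonneg hR (hnn _))).trans_eq (by ring))
        exact mixForm_nonneg hlam0 hlam1 _
      calc _ ≤ _ := h2
        _ ≤ R ^ 2 * R ^ (2 * m + 1) := by gcongr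
        _ = _ := by ring
  refine le_of_sq_le_sq ?_ (by positivity)
  calc _ ≤ _ := hsq _ (bddMeasurable_tiltIter hh m)
    _ ≤ R * R ^ (2 * m + 1) := by gcongr; exact hnorm m
    _ = _ := by ring

end SpectralGap

theorem tail_le_exp_mul_tiltIter {X : Type*} [MeasurableSpace X] {κ : Kernel X X}
    [IsMarkovKernel κ] {f : X → ℝ} {θ : ℝ} (hθ : 0 ≤ θ)
    (hh : BddMeasurable fun x => Real.exp (θ / 2 * f x)) {w : ℕ → ℝ → X → ℝ}
    (hw1 : ∀ s x, w 1 s x = if s ≤ f x then 1 else 0)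
    (hwS : ∀ m : ℕ, 1 ≤ m → ∀ s x, w (m + 1) s x = ∫ y, w m (s - f x) y ∂(κ x)) (m : ℕ) :
    ∀ s x, 0 ≤ w (m + 1) s x ∧ w (m + 1) s x ≤
      Real.exp (-(θ * s)) * (Real.exp (θ / 2 * f x) *
        tiltIter κ (fun x => Real.exp (θ / 2 * f x)) m x) := by
  induction m with
  | zero =>
    intro s x
    rw [hw1, tiltIter, ← Real.exp_add, ← Real.exp_add]
    split_ifs with h
    · refine ⟨zero_le_one, Real.one_le_exp ?_⟩
      nlinarith
    · exact ⟨le_rfl, (Real.exp_pos _).le⟩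
  | succ m ih =>
    intro s x
    rw [hwS (m + 1) (by omega)]
    refine ⟨integral_nonneg fun y => (ih _ y).1, ?_⟩
    refine (integral_mono_of_nonneg (ae_of_all _ fun y => (ih _ y).1)
      (((hh.mul (bddMeasurable_tiltIter hh m)).integrable (κ x)).const_mul _)
      (ae_of_all _ fun y => (ih (s - f x) y).2)).trans_eq ?_
    rw [integral_const_mul, tiltIter, ← mul_assoc (Real.exp (θ / 2 * f x)), ← mul_assoc,
      ← Real.exp_add, ← Real.exp_add]
    congr 2
    ring

theorem hoeffding_of_norm_sub_le
    {X : Type*} [MeasurableSpace X] {π : Measure X} [IsProbabilityMeasure π]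
    {κ : Kernel X X} [IsMarkovKernel κ] (hinv : π.bind κ = π)
    {lam : ℝ} (hlam0 : 0 < lam) (hlam1 : lam < 1)
    {P Pi : Lp ℝ 2 π →L[ℝ] Lp ℝ 2 π}
    (hP : ∀ g : Lp ℝ 2 π, P g =ᵐ[π] fun x => ∫ y, g y ∂(κ x))
    (hPi : ∀ g : Lp ℝ 2 π, Pi g =ᵐ[π] fun _ => ∫ y, g y ∂π)
    (hgap : ‖P - Pi‖ ≤ lam)
    {f : X → ℝ} (hf : Measurable f) (hf01 : ∀ x, f x ∈ Set.Icc (0 : ℝ) 1)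
    {μ : ℝ} (hμ : μ = ∫ x, f x ∂π)
    {w : ℕ → ℝ → X → ℝ}
    (hw1 : ∀ s x, w 1 s x = if s ≤ f x then 1 else 0)
    (hwS : ∀ m : ℕ, 1 ≤ m → ∀ s x, w (m + 1) s x = ∫ y, w m (s - f x) y ∂(κ x))
    {ε : ℝ} (hε : 0 < ε) (m : ℕ) :
    ∫ x, w (m + 1) ((m + 1 : ℕ) * (μ + ε)) x ∂π
      ≤ Real.exp (-2 * ((1 - lam) / (1 + lam)) * ε ^ 2 * (m + 1 : ℕ)) := by
  have hl1 : 0 < 1 - lam := sub_pos.2 hlam1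
  set θ : ℝ := 4 * ε * ((1 - lam) / (1 + lam)) with hθ
  have hθ0 : 0 < θ := by positivity
  set R := Real.exp (θ * μ + (1 + lam) / (1 - lam) * θ ^ 2 / 8) with hR
  have hfi : Integrable f π := BddMeasurable.integrable
    ⟨hf, 1, fun x => abs_le.2 ⟨by linarith [(hf01 x).1], (hf01 x).2⟩⟩ π
  have hμ0 : 0 ≤ μ := hμ ▸ integral_nonneg fun x => (hf01 x).1
  obtain ⟨hRW, htwo⟩ := two_point_bound hlam0 hlam1 hθ0 hμ0 hR
  have hh : BddMeasurable fun x => Real.exp (θ / 2 * f x) := by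
    refine ⟨(hf.const_mul _).exp, Real.exp (θ / 2), fun x => ?_⟩
    rw [abs_of_pos (Real.exp_pos _), Real.exp_le_exp]
    nlinarith [(hf01 x).2]
  have hsq : ∀ x, Real.exp (θ / 2 * f x) ^ 2 = Real.exp (θ * f x) := fun x => by
    rw [← Real.exp_nat_mul]; congr 1; push_cast; ring
  have hd : ∀ x, R - lam * Real.exp θ ≤ R - lam * Real.exp (θ / 2 * f x) ^ 2 := fun x => by
    rw [hsq]; gcongr; nlinarith [(hf01 x).2]
  have hK : (1 - lam) * ∫ x, Real.exp (θ / 2 * f x) ^ 2 /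
      (R - lam * Real.exp (θ / 2 * f x) ^ 2) ∂π ≤ 1 := by
    refine (mul_le_mul_of_nonneg_left ?_ hl1.le).trans htwo
    have i1 : Integrable (fun x => (1 - f x) / (R - lam)) π :=
      ((integrable_const _).sub' hfi).div_const _
    have i2 : Integrable (fun x => f x * (Real.exp θ / (R - lam * Real.exp θ))) π :=
      hfi.mul_const _
    have e : ∫ x, ((1 - f x) / (R - lam) + f x * (Real.exp θ / (R - lam * Real.exp θ))) ∂π =
        (1 - μ) / (R - lam) + μ * (Real.exp θ / (R - lam * Real.exp θ)) := by
      rw [integral_add i1 i2, integral_div, integral_mul_const,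
        integral_sub (integrable_const _) hfi, ← hμ]
      simp
    rw [← e]
    refine integral_mono_of_nonneg (ae_of_all _ fun x => ?_) (i1.add i2) (ae_of_all _ fun x => ?_)
    · exact div_nonneg (sq_nonneg _) ((sub_pos.2 hRW).le.trans (hd x))
    · simp only [hsq]
      refine div_sub_mul_le_chord hlam0.le (hf01 x).1 (hf01 x).2 ?_ (Real.one_le_exp hθ0.le) hRW
      have := convexOn_exp.2 (Set.mem_univ 0) (Set.mem_univ θ) (sub_nonneg.2 (hf01 x).2)
        (hf01 x).1 (by ring)
      simpa [mul_comm] using this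
  have hiter := integral_mul_tiltIter_le (κ := κ) hh (Real.exp_pos _).le hlam0.le hlam1.le
    (fun a b ha hb => sq_integral_mul_kernel_le hinv hP hPi hgap ha hb)
    (fun g hg => mixForm_mul_le hh hg hlam1 (sub_pos.2 hRW) hd hK) m
  have htail := tail_le_exp_mul_tiltIter hθ0.le hh hw1 hwS m ((m + 1 : ℕ) * (μ + ε))
  calc _ ≤ ∫ x, Real.exp (-(θ * ((m + 1 : ℕ) * (μ + ε)))) * (Real.exp (θ / 2 * f x) *
        tiltIter κ (fun x => Real.exp (θ / 2 * f x)) m x) ∂π :=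
      integral_mono_of_nonneg (ae_of_all _ fun x => (htail x).1)
        (((hh.mul (bddMeasurable_tiltIter hh m)).integrable π).const_mul _)
        (ae_of_all _ fun x => (htail x).2)
    _ ≤ Real.exp (-(θ * ((m + 1 : ℕ) * (μ + ε)))) * R ^ (m + 1) := by
      rw [integral_const_mul]; gcongr
    _ = _ := by
      rw [hR, ← Real.exp_nat_mul, ← Real.exp_add, hθ]
      congr 1
      field_simp
      ring

/-- main Hoeffding-type inequality, Theorem 3.2: for a stationary,
`ψ`-irreducible Markov chain with kernel `κ`, invariant law `π` and `L²(π)` spectral gap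
`‖P - Π‖ = λ < 1`, and `f : X → [0,1]` with `μ = π(f)`, one has for all `ε > 0` with
`μ + ε < 1`:
`ℙ_π(Sₙ ≥ n(μ+ε)) ≤ exp(-2 ((1-λ)/(1+λ)) ε² n)`.
Here `ℙ_π(Sₙ ≥ c) = ∫ w n c dπ`, where `w m s x` is the probability, starting at `X₁ = x`,
that `f(X₁)+⋯+f(X_m) ≥ s`, given by the backward recursion below. -/
theorem hoeffding_stmt19
    {X : Type*} [MeasurableSpace X] (π : Measure X) [IsProbabilityMeasure π]
    (κ : Kernel X X) [IsMarkovKernel κ] (hinv : π.bind κ = π)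
    -- ψ-irreducibility (via the n-step kernels)
    (κiter : ℕ → Kernel X X) (hκ1 : κiter 1 = κ)
    (hκS : ∀ n : ℕ, 1 ≤ n → κiter (n + 1) = κ ∘ₖ κiter n)
    (hirr : ∃ ψ : Measure X, ψ ≠ 0 ∧ ∀ A : Set X, MeasurableSet A → 0 < ψ A →
      ∀ x, ∃ n : ℕ, 1 ≤ n ∧ 0 < κiter n x A)
    -- spectral gap assumption on the transition operator `P` acting on `L²(π)`
    (lam : ℝ) (hlam1 : lam < 1)
    (P Pi : Lp ℝ 2 π →L[ℝ] Lp ℝ 2 π)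
    (hP : ∀ g : Lp ℝ 2 π, P g =ᵐ[π] fun x => ∫ y, g y ∂(κ x))
    (hPi : ∀ g : Lp ℝ 2 π, Pi g =ᵐ[π] fun _ => ∫ y, g y ∂π)
    (hgap : ‖P - Pi‖ = lam)
    -- the function `f` and its stationary mean
    (f : X → ℝ) (hf : Measurable f) (hf01 : ∀ x, f x ∈ Set.Icc (0 : ℝ) 1)
    (μ : ℝ) (hμ : μ = ∫ x, f x ∂π)
    -- tail probabilities of the partial sums, via the backward recursion
    (w : ℕ → ℝ → X → ℝ)
    (hw1 : ∀ s x, w 1 s x = if s ≤ f x then 1 else 0)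
    (hwS : ∀ m : ℕ, 1 ≤ m → ∀ s x, w (m + 1) s x = ∫ y, w m (s - f x) y ∂(κ x))
    (ε : ℝ) (hε : 0 < ε) (hμε : μ + ε < 1) :
    ∀ n : ℕ, 1 ≤ n →
      ∫ x, w n (n * (μ + ε)) x ∂π
        ≤ Real.exp (-2 * ((1 - lam) / (1 + lam)) * ε ^ 2 * n) := by
  intro n hn
  obtain ⟨m, rfl⟩ : ∃ m, n = m + 1 := ⟨n - 1, by omega⟩
  have h0 : 0 ≤ lam := hgap ▸ norm_nonneg _
  have hcont : ContinuousAt (fun l : ℝ =>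
      Real.exp (-2 * ((1 - l) / (1 + l)) * ε ^ 2 * (m + 1 : ℕ))) lam := by
    have : 1 + lam ≠ 0 := by positivity
    fun_prop (disch := assumption)
  refine ge_of_tendsto (hcont.tendsto.mono_left (nhdsWithin_le_nhds (s := Set.Ioi lam))) ?_
  filter_upwards [Ioo_mem_nhdsGT hlam1] with l hl
  exact hoeffding_of_norm_sub_le hinv (h0.trans_lt hl.1) hl.2 hP hPi (hgap.le.trans hl.1.le)
    hf hf01 hμ hw1 hwS hε m
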